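/- Let k be a positive integer, σ ∈ ℝ, and q(t) := c_k·cos(2πk(t+σ)) with c_k := 2^(−1/6)·(πk)^(−1/3). Then, independently of σ: (i) the constant function 1 satisfies A_q(1) = −4π²k²·1; (ii) for every positive integer n ≠ k, A_q(cos 2πn·) = 4π²(n²−k²)·cos 2πn· and A_q(sin 2πn·) = 4π²(n²−k²)·sin 2πn·; (iii) A_q(cos 2πk(·+σ)) = 12(2πk)²·cos 2πk(·+σ); (iv) A_q(sin 2πk(·+σ)) = 0. -/

import Mathlib

open Real

/-- L² inner product of 1-periodic functions: `⟨f,g⟩ = ∫₀¹ f(t)g(t) dt`. -/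
noncomputable def ip (f g : ℝ → ℝ) : ℝ := ∫ t in (0:ℝ)..1, f t * g t

/-- The amplitude `c_k = 2^(-1/6) (πk)^(-1/3)`. -/
noncomputable def ck (k : ℕ) : ℝ := 2 ^ (-(1:ℝ)/6) * (Real.pi * k) ^ (-(1:ℝ)/3)

/-- `α_q = ‖q̇‖²/‖q‖² − 1/(2‖q‖⁶)`, with `‖q‖² = ⟨q,q⟩`. -/
noncomputable def alphaQ (q : ℝ → ℝ) : ℝ :=
  ip (deriv q) (deriv q) / ip q q - 1 / (2 * (ip q q) ^ 3)

/-- The Hessian operator of `ℬ` at a critical point `q`: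
`A_q ξ = −ξ̈ + α_q ξ − (2/‖q‖²)(2α_q − 1/‖q‖⁶)⟨q,ξ⟩ q`. -/
noncomputable def Hess (q ξ : ℝ → ℝ) : ℝ → ℝ := fun t =>
  -(deriv (deriv ξ) t) + alphaQ q * ξ t
    - (2 / ip q q) * (2 * alphaQ q - 1 / (ip q q) ^ 3) * ip q ξ * q t

lemma integral_cos_two_pi_int_mul_add {m : ℤ} (hm : m ≠ 0) (b : ℝ) :
    ∫ t in (0:ℝ)..1, Real.cos (2 * π * m * t + b) = 0 := by
  have hc : 2 * π * (m : ℝ) ≠ 0 := by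
    have : (m : ℝ) ≠ 0 := by exact_mod_cast hm
    positivity
  rw [intervalIntegral.integral_comp_mul_add (fun x => Real.cos x) hc b, integral_cos]
  have h : 2 * π * (m : ℝ) * 1 + b = b + m * (2 * π) := by ring
  rw [h, Real.sin_add_int_mul_two_pi]
  simp

lemma ip_cos_cos (k n : ℕ) (a b : ℝ) :
    ip (fun t => Real.cos (2 * π * k * t + a)) (fun t => Real.cos (2 * π * n * t + b)) =
      ((∫ t in (0:ℝ)..1, Real.cos (2 * π * ((k + n : ℤ) : ℝ) * t + (a + b))) +
        ∫ t in (0:ℝ)..1, Real.cos (2 * π * ((k - n : ℤ) : ℝ) * t + (a - b))) / 2 := by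
  rw [← intervalIntegral.integral_add (Continuous.intervalIntegrable (by fun_prop) _ _)
    (Continuous.intervalIntegrable (by fun_prop) _ _), ← intervalIntegral.integral_div]
  refine intervalIntegral.integral_congr fun t _ => ?_
  have h₁ : 2 * π * ((k + n : ℤ) : ℝ) * t + (a + b) =
      (2 * π * k * t + a) + (2 * π * n * t + b) := by push_cast; ring
  have h₂ : 2 * π * ((k - n : ℤ) : ℝ) * t + (a - b) =
      (2 * π * k * t + a) - (2 * π * n * t + b) := by push_cast; ring
  simp only [h₁, h₂, Real.cos_add (2 * π * k * t + a), Real.cos_sub (2 * π * k * t + a)]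
  ring

lemma ip_cos_cos_of_ne {k n : ℕ} (hk : 0 < k) (h : n ≠ k) (a b : ℝ) :
    ip (fun t => Real.cos (2 * π * k * t + a)) (fun t => Real.cos (2 * π * n * t + b)) = 0 := by
  rw [ip_cos_cos, integral_cos_two_pi_int_mul_add (by omega),
    integral_cos_two_pi_int_mul_add (by omega)]
  simp

lemma ip_cos_cos_self {k : ℕ} (hk : 0 < k) (a b : ℝ) :
    ip (fun t => Real.cos (2 * π * k * t + a)) (fun t => Real.cos (2 * π * k * t + b)) =
      Real.cos (a - b) / 2 := by
  rw [ip_cos_cos, integral_cos_two_pi_int_mul_add (by omega)]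
  simp

lemma ip_const_mul_left (c : ℝ) (f g : ℝ → ℝ) : ip (fun t => c * f t) g = c * ip f g := by
  simp only [ip, mul_assoc, intervalIntegral.integral_const_mul]

lemma ip_const_mul_right (c : ℝ) (f g : ℝ → ℝ) : ip f (fun t => c * g t) = c * ip f g := by
  simp only [ip, mul_left_comm _ c, intervalIntegral.integral_const_mul]

lemma deriv_cos_mul_add (w b : ℝ) :
    deriv (fun t => Real.cos (w * t + b)) = fun t => w * Real.cos (w * t + (b + π / 2)) := by
  funext t
  have h : HasDerivAt (fun t => w * t + b) w t := by
    simpa using ((hasDerivAt_id t).const_mul w).add_const b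
  rw [h.cos.deriv, ← add_assoc, Real.cos_add_pi_div_two, mul_comm]

lemma deriv_deriv_cos_mul_add (w b t : ℝ) :
    deriv (deriv fun t => Real.cos (w * t + b)) t = -w ^ 2 * Real.cos (w * t + b) := by
  rw [deriv_cos_mul_add, deriv_const_mul_field, deriv_cos_mul_add]
  have h : w * t + (b + π / 2 + π / 2) = w * t + b + π := by ring
  simp only [h, Real.cos_add_pi]
  ring

lemma ck_pos {k : ℕ} (hk : 0 < k) : 0 < ck k := by
  unfold ck
  positivity

lemma ck_pow_six {k : ℕ} (hk : 0 < k) : ck k ^ 6 = 1 / (2 * (π * k) ^ 2) := by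
  have hpk : 0 ≤ π * k := by positivity
  have h₁ : ((2:ℝ) ^ (-(1:ℝ) / 6)) ^ 6 = 2⁻¹ := by
    rw [← Real.rpow_natCast, ← Real.rpow_mul (by norm_num), ← Real.rpow_neg_one]
    norm_num
  have h₂ : ((π * k) ^ (-(1:ℝ) / 3)) ^ 6 = ((π * k) ^ 2)⁻¹ := by
    rw [← Real.rpow_natCast, ← Real.rpow_mul hpk, ← Real.rpow_natCast (π * k) 2,
      ← Real.rpow_neg hpk]
    norm_num
  rw [ck, mul_pow, h₁, h₂, one_div, mul_inv]

lemma ip_self_ck_cos {k : ℕ} (hk : 0 < k) (a : ℝ) :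
    ip (fun t => ck k * Real.cos (2 * π * k * t + a))
      (fun t => ck k * Real.cos (2 * π * k * t + a)) = ck k ^ 2 / 2 := by
  rw [ip_const_mul_left, ip_const_mul_right, ip_cos_cos_self hk]
  simp
  ring

lemma ck_sq_half_pow_three {k : ℕ} (hk : 0 < k) :
    1 / (ck k ^ 2 / 2) ^ 3 = 16 * (π * k) ^ 2 := by
  have h : (ck k ^ 2 / 2) ^ 3 = ck k ^ 6 / 8 := by ring
  rw [h, ck_pow_six hk]
  field_simp
  norm_num

lemma alphaQ_ck_cos {k : ℕ} (hk : 0 < k) (a : ℝ) :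
    alphaQ (fun t => ck k * Real.cos (2 * π * k * t + a)) = -(2 * π * k) ^ 2 := by
  have hc := (ck_pos hk).ne'
  have hd : deriv (fun t => ck k * Real.cos (2 * π * k * t + a)) =
      fun t => ck k * (2 * π * k * Real.cos (2 * π * k * t + (a + π / 2))) := by
    funext t
    rw [deriv_const_mul_field, deriv_cos_mul_add]
  have h : 1 / (2 * (ck k ^ 2 / 2) ^ 3) = 8 * (π * k) ^ 2 := by
    rw [one_div, mul_inv, ← one_div ((ck k ^ 2 / 2) ^ 3), ck_sq_half_pow_three hk]
    ring
  rw [alphaQ, ip_self_ck_cos hk, h, hd]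
  simp only [ip_const_mul_left, ip_const_mul_right, ip_cos_cos_self hk, sub_self, Real.cos_zero]
  field_simp
  ring

/-- The Hessian at `c_k cos(2πkt + a)`, with its scalar coefficients evaluated. -/
lemma hess_ck_cos {k : ℕ} (hk : 0 < k) (a : ℝ) (ξ : ℝ → ℝ) (t : ℝ) :
    Hess (fun t => ck k * Real.cos (2 * π * k * t + a)) ξ t =
      -(deriv (deriv ξ) t) - (2 * π * k) ^ 2 * ξ t + 24 * (2 * π * k) ^ 2 *
        ip (fun t => Real.cos (2 * π * k * t + a)) ξ * Real.cos (2 * π * k * t + a) := by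
  have hc := (ck_pos hk).ne'
  rw [Hess, alphaQ_ck_cos hk, ip_self_ck_cos hk, ck_sq_half_pow_three hk, ip_const_mul_left]
  field_simp
  ring

lemma hess_ck_cos_cos_of_ne {k : ℕ} (hk : 0 < k) (a : ℝ) {n : ℕ} (hn : n ≠ k) (b t : ℝ) :
    Hess (fun t => ck k * Real.cos (2 * π * k * t + a))
      (fun t => Real.cos (2 * π * n * t + b)) t =
      4 * π ^ 2 * ((n : ℝ) ^ 2 - (k : ℝ) ^ 2) * Real.cos (2 * π * n * t + b) := by
  rw [hess_ck_cos hk, deriv_deriv_cos_mul_add, ip_cos_cos_of_ne hk hn]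
  ring

lemma hess_ck_cos_cos_self {k : ℕ} (hk : 0 < k) (a b t : ℝ) :
    Hess (fun t => ck k * Real.cos (2 * π * k * t + a))
      (fun t => Real.cos (2 * π * k * t + b)) t =
      12 * (2 * π * k) ^ 2 * Real.cos (a - b) * Real.cos (2 * π * k * t + a) := by
  rw [hess_ck_cos hk, deriv_deriv_cos_mul_add, ip_cos_cos_self hk]
  ring

/-- Eigenvectors and eigenvalues of the Hessian at `q(t) = c_k cos(2πk(t+σ))`,
independently of `σ`: the constant function has eigenvalue `−4π²k²`, the modes
`cos 2πnt, sin 2πnt` (`n ≠ k`) have eigenvalue `4π²(n²−k²)`, the shifted mode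
`cos 2πk(t+σ)` has eigenvalue `12(2πk)²`, and `sin 2πk(t+σ)` lies in the kernel. -/
theorem hessian_eigenvectors (k : ℕ) (hk : 0 < k) (σ : ℝ) (q : ℝ → ℝ)
    (hq : ∀ t, q t = ck k * Real.cos (2 * π * k * (t + σ))) :
    (∀ t, Hess q (fun _ => 1) t = -(4 * π ^ 2 * k ^ 2) * 1) ∧
    (∀ n : ℕ, 0 < n → n ≠ k →
      (∀ t, Hess q (fun r => Real.cos (2 * π * n * r)) t
          = 4 * π ^ 2 * ((n : ℝ) ^ 2 - (k : ℝ) ^ 2) * Real.cos (2 * π * n * t)) ∧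
      (∀ t, Hess q (fun r => Real.sin (2 * π * n * r)) t
          = 4 * π ^ 2 * ((n : ℝ) ^ 2 - (k : ℝ) ^ 2) * Real.sin (2 * π * n * t))) ∧
    (∀ t, Hess q (fun r => Real.cos (2 * π * k * (r + σ))) t
        = 12 * (2 * π * k) ^ 2 * Real.cos (2 * π * k * (t + σ))) ∧
    (∀ t, Hess q (fun r => Real.sin (2 * π * k * (r + σ))) t = 0) := by
  have hphase (r : ℝ) : 2 * π * k * (r + σ) = 2 * π * k * r + 2 * π * k * σ := by ring
  have hsin (x : ℝ) : Real.sin x = Real.cos (x + -(π / 2)) := by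
    rw [← sub_eq_add_neg, Real.cos_sub_pi_div_two]
  obtain rfl : q = fun t => ck k * Real.cos (2 * π * k * t + 2 * π * k * σ) :=
    funext fun t => by rw [hq, hphase]
  simp only [hphase, hsin, add_assoc]
  refine ⟨fun t => ?_, fun n _ hn => ⟨fun t => ?_, fun t => ?_⟩, fun t => ?_, fun t => ?_⟩
  · have h := hess_ck_cos_cos_of_ne hk (2 * π * k * σ) hk.ne 0 t
    simp only [Nat.cast_zero, mul_zero, zero_mul, add_zero, Real.cos_zero] at h
    rw [h]
    ring
  · simpa only [add_zero] using hess_ck_cos_cos_of_ne hk (2 * π * k * σ) hn 0 t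
  · exact hess_ck_cos_cos_of_ne hk _ hn _ t
  · simpa using hess_ck_cos_cos_self hk (2 * π * k * σ) (2 * π * k * σ) t
  · simp [hess_ck_cos_cos_self hk]
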